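/- Let E be a finite directed graph without sinks, with a chosen special edge at each vertex, and let k be a field. The injective Leavitt complex of E is acyclic: for every integer l, the kernel of ∂^l equals the image of ∂^{l−1}. -/

import Mathlib

open scoped Classical

/-- `IsPathOn s t v es` says that the list of edges `es` (in traversal order,
i.e. the first-applied edge first) forms a path starting at the vertex `v`
in the graph with source map `s` and target map `t`. -/
def IsPathOn {V E : Type} (s t : E → V) : V → List E → Prop
  | _, [] => True
  | v, a :: rest => s a = v ∧ IsPathOn s t (t a) rest

/-- A path is encoded as a pair: its starting vertex together with its list of
edges in traversal order.  A trivial path `e_i` is `(i, [])`. -/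
def IsPath {V E : Type} (s t : E → V) (p : V × List E) : Prop :=
  IsPathOn s t p.1 p.2

/-- The terminating vertex of a path. -/
def pterm {V E : Type} (t : E → V) (p : V × List E) : V :=
  p.2.getLast?.elim p.1 t

/-- `(p, q)` is an admissible pair with respect to the choice of special edges
`sp` (where `sp i` is the special edge starting at `i`). -/
def Admissible {V E : Type} (s t : E → V) (sp : V → E) (p q : V × List E) : Prop :=
  IsPath s t p ∧ IsPath s t q ∧ pterm t p = pterm t q ∧
    (p.2 = [] ∨ q.2 = [] ∨
      ∃ a b, p.2.getLast? = some a ∧ q.2.getLast? = some b ∧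
        (a ≠ b ∨ (a = b ∧ a ∉ Set.range sp)))

/-- The index type for the basis of the injective Leavitt complex.  The index
`(none, p, q)` stands for the basis vector `e_i^♯ ζ_(p,q)` (with `i = s(q)`),
and `(some α, p, q)` stands for `α^♯ ζ_(p,q)` (with `t(α) = i = s(q)`). -/
abbrev IdxI (V E : Type) := Option E × ((V × List E) × (V × List E))

/-- The valid indices in degree `l`: `(p, q)` is an admissible pair with
`l(q) - l(p) = l`, and the optional edge `α` satisfies `t(α) = s(q)`. -/
def ValidIdxI {V E : Type} (s t : E → V) (sp : V → E) (l : ℤ) (x : IdxI V E) : Prop :=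
  Admissible s t sp x.2.1 x.2.2 ∧
    ((x.2.2.2.length : ℤ) - (x.2.1.2.length : ℤ) = l) ∧
    ∀ a ∈ x.1, t a = x.2.2.1

/-- The degree-`l` component `I^l` of the injective Leavitt complex, realized
as the span of the valid degree-`l` basis vectors inside the free `k`-module
on all indices. -/
noncomputable def IComp (k : Type) [Field k] {V E : Type} (s t : E → V)
    (sp : V → E) (l : ℤ) : Submodule k (IdxI V E →₀ k) :=
  Submodule.span k {f | ∃ x, ValidIdxI s t sp l x ∧ f = Finsupp.single x 1}

/-- The value of the differential of the injective Leavitt complex on a basis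
vector:  `∂(e_i^♯ ζ_(p,q)) = 0`;  if `q = e_i`, `p = α p̂` and `α` is special,
then `∂(α^♯ ζ_(p,q)) = e_{s(α)}^♯ ζ_(p̂, e_{s(α)}) - ∑_{β ∈ S(α)}
e_{s(α)}^♯ ζ_(β p̂, β)`;  otherwise `∂(α^♯ ζ_(p,q)) = e_{s(α)}^♯ ζ_(p, qα)`. -/
noncomputable def DsingleI (k : Type) [Field k] {V E : Type} [Fintype E]
    (s : E → V) (sp : V → E) (x : IdxI V E) : IdxI V E →₀ k :=
  match x with
  | (none, _, _) => 0
  | (some α, p, q) =>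
    if q.2 = [] ∧ p.2.getLast? = some α ∧ α ∈ Set.range sp then
      Finsupp.single ((none : Option E), (p.1, p.2.dropLast), (s α, ([] : List E))) 1 -
        ∑ β ∈ Finset.univ.filter fun β => s β = s α ∧ β ≠ α,
          Finsupp.single ((none : Option E), (p.1, p.2.dropLast ++ [β]), (s β, [β])) 1
    else Finsupp.single ((none : Option E), p, (s α, α :: q.2)) 1

/-- The differential of the injective Leavitt complex, as a `k`-linear
endomorphism of the free module on all indices (its restriction to `IComp l`
is the differential `∂^l : I^l → I^{l+1}`). -/
noncomputable def DI (k : Type) [Field k] {V E : Type} [Fintype E]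
    (s : E → V) (sp : V → E) : (IdxI V E →₀ k) →ₗ[k] (IdxI V E →₀ k) :=
  Finsupp.linearCombination k (DsingleI k s sp)


section LeavittAux

theorem pterm_nil {V E : Type} (t : E → V) (v : V) : pterm t (v, ([] : List E)) = v := rfl

theorem pterm_concat {V E : Type} (t : E → V) (v : V) (l : List E) (b : E) :
    pterm t (v, l ++ [b]) = t b := by
  simp [pterm]

theorem pterm_cons {V E : Type} (t : E → V) (v : V) (a : E) (l : List E) :
    pterm t (v, a :: l) = pterm t (t a, l) := by
  rcases List.eq_nil_or_concat' l with rfl | ⟨l', b, rfl⟩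
  · simp [pterm]
  · rw [pterm_concat, ← List.cons_append, pterm_concat]

theorem isPathOn_concat {V E : Type} (s t : E → V) (l : List E) (b : E) (v : V) :
    IsPathOn s t v (l ++ [b]) ↔ IsPathOn s t v l ∧ s b = pterm t (v, l) := by
  induction l generalizing v with
  | nil => simp [IsPathOn, pterm_nil]
  | cons a l ih => simp [IsPathOn, pterm_cons, ih, and_assoc]

/-- The contracting homotopy on basis vectors. -/
noncomputable def HsingleI (k : Type) [Field k] {V E : Type} [Fintype E]
    (s t : E → V) (sp : V → E) (x : IdxI V E) : IdxI V E →₀ k :=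
  match x with
  | (some _, _, _) => 0
  | (none, p, (i, [])) =>
      Finsupp.single (some (sp i), (p.1, p.2 ++ [sp i]), (t (sp i), ([] : List E))) 1 +
        ∑ β ∈ Finset.univ.filter fun β => s β = i ∧ β ≠ sp i,
          Finsupp.single (some β, (p.1, p.2 ++ [β]), (t β, ([] : List E))) 1
  | (none, p, (_, α :: q)) => Finsupp.single (some α, p, (t α, q)) 1

/-- The contracting homotopy. -/
noncomputable def HI (k : Type) [Field k] {V E : Type} [Fintype E]
    (s t : E → V) (sp : V → E) : (IdxI V E →₀ k) →ₗ[k] (IdxI V E →₀ k) :=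
  Finsupp.linearCombination k (HsingleI k s t sp)

theorem not_special {V E : Type} {s : E → V} {sp : V → E} (hsp : ∀ i, s (sp i) = i)
    {β : E} {i : V} (h : s β = i) (hne : β ≠ sp i) : β ∉ Set.range sp := by
  rintro ⟨j, rfl⟩
  rw [hsp] at h
  exact hne (by rw [h])

theorem single_mem_IComp (k : Type) [Field k] {V E : Type} {s t : E → V}
    {sp : V → E} {l : ℤ} {x : IdxI V E} (h : ValidIdxI s t sp l x) :
    Finsupp.single x (1 : k) ∈ IComp k s t sp l :=
  Submodule.subset_span ⟨x, h, rfl⟩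

variable (k : Type) [Field k] {V E : Type} [Fintype E] (s t : E → V) (sp : V → E)

theorem DI_single (x : IdxI V E) : DI k s sp (Finsupp.single x 1) = DsingleI k s sp x := by
  simp [DI]

theorem HI_single (x : IdxI V E) : HI k s t sp (Finsupp.single x 1) = HsingleI k s t sp x := by
  simp [HI]

theorem DI_DI (y : IdxI V E →₀ k) : DI k s sp (DI k s sp y) = 0 := by
  induction y using Finsupp.induction_linear with
  | zero => simp
  | add f g hf hg => simp [hf, hg]
  | single x c =>
    rw [← mul_one c, ← smul_eq_mul, ← Finsupp.smul_single, map_smul, map_smul, DI_single]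
    obtain ⟨a, p, q⟩ := x
    cases a with
    | none => simp [DsingleI]
    | some α =>
      simp only [DsingleI]
      split_ifs
      · simp only [map_sub, map_sum, DI_single, DsingleI]
        simp
      · simp only [DI_single, DsingleI]
        simp

theorem D_mem (hsp : ∀ i, s (sp i) = i) {l : ℤ} {x : IdxI V E} (h : ValidIdxI s t sp l x) :
    DsingleI k s sp x ∈ IComp k s t sp (l + 1) := by
  obtain ⟨a, ⟨v, p⟩, ⟨i, q⟩⟩ := x
  cases a with
  | none => simp [DsingleI]
  | some α =>
    obtain ⟨⟨hp, hq, hpq, hadm⟩, hl, ha⟩ := h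
    simp only [IsPath] at hp hq
    simp only [Option.mem_def, Option.some.injEq, forall_eq'] at ha hpq hadm hl
    simp only [DsingleI]
    split_ifs with hc
    · obtain ⟨rfl, hlast, ⟨j, rfl⟩⟩ := hc
      rcases List.eq_nil_or_concat' p with rfl | ⟨p', b, rfl⟩
      · simp at hlast
      · simp at hlast
        subst hlast
        rw [isPathOn_concat] at hp
        simp only [List.dropLast_concat]
        refine Submodule.sub_mem _ (single_mem_IComp k ?_) (Submodule.sum_mem _ ?_)
        · refine ⟨⟨hp.1, trivial, ?_, by simp⟩, ?_, by simp⟩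
          · exact hp.2.symm
          · simp at hl ⊢; omega
        · intro β hβ
          simp only [Finset.mem_filter, Finset.mem_univ, true_and] at hβ
          rw [hsp] at hβ hp
          refine single_mem_IComp k ⟨⟨?_, ⟨rfl, trivial⟩, ?_, ?_⟩, ?_, by simp⟩
          · exact (isPathOn_concat ..).2 ⟨hp.1, hβ.1.trans hp.2⟩
          · simp [pterm]
          · right; right
            exact ⟨β, β, by simp, by simp, Or.inr ⟨rfl, not_special hsp hβ.1 hβ.2⟩⟩
          · simp at hl ⊢; omega
    · refine single_mem_IComp k ⟨⟨hp, ⟨rfl, ?_⟩, ?_, ?_⟩, ?_, by simp⟩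
      · simpa [ha] using hq
      · rw [pterm_cons, ha]; exact hpq
      · rcases List.eq_nil_or_concat' q with rfl | ⟨q', b, rfl⟩
        · rcases List.eq_nil_or_concat' p with rfl | ⟨p', b, rfl⟩
          · simp
          · right; right
            refine ⟨b, α, by simp, by simp, ?_⟩
            by_cases hb : b = α
            · right
              refine ⟨hb, fun hr => hc ⟨rfl, by simp [hb], hb ▸ hr⟩⟩
            · exact Or.inl hb
        · rcases hadm with h | h | ⟨a, b', h1, h2, h3⟩
          · exact Or.inl h
          · simp at h
          · right; right
            refine ⟨a, b', h1, ?_, h3⟩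
            change (α :: (q' ++ [b])).getLast? = some b'
            rw [← List.cons_append]
            rw [List.getLast?_concat] at h2 ⊢
            exact h2
      · simp at hl ⊢; omega

theorem H_mem (hsp : ∀ i, s (sp i) = i) {l : ℤ} {x : IdxI V E} (h : ValidIdxI s t sp l x) :
    HsingleI k s t sp x ∈ IComp k s t sp (l - 1) := by
  obtain ⟨a, ⟨v, p⟩, ⟨i, q⟩⟩ := x
  cases a with
  | some α => simp [HsingleI]
  | none =>
    obtain ⟨⟨hp, hq, hpq, hadm⟩, hl, -⟩ := h
    simp only [IsPath] at hp hq
    simp only at hpq hadm hl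
    cases q with
    | nil =>
      have key : ∀ β, s β = i → Finsupp.single
          ((some β, (v, p ++ [β]), (t β, ([] : List E))) : IdxI V E) (1 : k)
            ∈ IComp k s t sp (l - 1) := by
        intro β hβ
        refine single_mem_IComp k ⟨⟨?_, trivial, ?_, by simp⟩, ?_, by simp⟩
        · exact (isPathOn_concat ..).2 ⟨hp, hβ.trans hpq.symm⟩
        · simp [pterm]
        · simp at hl ⊢; omega
      simp only [HsingleI]
      refine Submodule.add_mem _ (key _ (hsp i)) (Submodule.sum_mem _ ?_)
      intro β hβ
      simp only [Finset.mem_filter, Finset.mem_univ, true_and] at hβ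
      exact key β hβ.1
    | cons α q =>
      simp only [HsingleI]
      refine single_mem_IComp k ⟨⟨hp, hq.2, ?_, ?_⟩, ?_, by simp⟩
      · rw [hpq, pterm_cons]
      · rcases List.eq_nil_or_concat' q with rfl | ⟨q', b, rfl⟩
        · simp
        · rcases hadm with h | h | ⟨a, b', h1, h2, h3⟩
          · exact Or.inl h
          · simp at h
          · right; right
            refine ⟨a, b', h1, ?_, h3⟩
            rw [← List.cons_append] at h2
            change (q' ++ [b]).getLast? = some b'
            rw [List.getLast?_concat] at h2 ⊢
            exact h2
      · simp at hl ⊢; omega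

theorem homotopy_single (hsp : ∀ i, s (sp i) = i) {l : ℤ} {x : IdxI V E}
    (h : ValidIdxI s t sp l x) :
    DI k s sp (HsingleI k s t sp x) + HI k s t sp (DsingleI k s sp x) = Finsupp.single x 1 := by
  obtain ⟨a, ⟨v, p⟩, ⟨i, q⟩⟩ := x
  obtain ⟨⟨hp, hq, hpq, hadm⟩, hl, ha⟩ := h
  simp only [IsPath] at hp hq
  simp only at hpq hadm hl
  cases a with
  | none =>
    cases q with
    | nil =>
      simp only [HsingleI, DsingleI, map_add, map_sum, DI_single, map_zero, add_zero]
      rw [if_pos ⟨trivial, by simp, ⟨i, rfl⟩⟩]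
      have : ∀ β ∈ Finset.univ.filter (fun β => s β = i ∧ β ≠ sp i),
          (if True ∧ (p ++ [β]).getLast? = some β ∧ β ∈ Set.range sp then
            Finsupp.single ((none, (v, (p ++ [β]).dropLast), (s β, [])) : IdxI V E) (1 : k) -
            ∑ γ ∈ Finset.univ.filter fun γ => s γ = s β ∧ γ ≠ β,
              Finsupp.single (none, (v, (p ++ [β]).dropLast ++ [γ]), (s γ, [γ])) 1
          else Finsupp.single (none, (v, p ++ [β]), (s β, [β])) 1) =
          Finsupp.single ((none, (v, p ++ [β]), (s β, [β])) : IdxI V E) (1 : k) := by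
        intro β hβ
        simp only [Finset.mem_filter, Finset.mem_univ, true_and] at hβ
        exact if_neg fun hc => not_special hsp hβ.1 hβ.2 hc.2.2
      rw [Finset.sum_congr rfl this]
      simp only [List.dropLast_concat, hsp]
      abel
    | cons α q =>
      obtain ⟨rfl, hq⟩ := hq
      simp only [HsingleI, DsingleI, DI_single, map_zero, add_zero]
      rw [if_neg]
      rintro ⟨rfl, h1, h2⟩
      rcases hadm with h | h | ⟨a, b, h3, h4, h5⟩
      · subst h; simp at h1
      · simp at h
      · simp at h4
        simp only [h1, Option.some.injEq] at h3
        subst h3 h4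
        simp [h2] at h5
  | some α =>
    simp only [Option.mem_def, Option.some.injEq, forall_eq'] at ha
    subst ha
    simp only [HsingleI, DsingleI, map_zero, zero_add]
    split_ifs with hc
    · obtain ⟨rfl, hlast, ⟨j, rfl⟩⟩ := hc
      rcases List.eq_nil_or_concat' p with rfl | ⟨p', b, rfl⟩
      · simp at hlast
      · simp at hlast
        subst hlast
        simp only [map_sub, map_sum, HI_single, HsingleI, List.dropLast_concat, hsp]
        abel
    · simp only [HI_single, HsingleI]

theorem homotopy (hsp : ∀ i, s (sp i) = i) {l : ℤ} {y : IdxI V E →₀ k}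
    (h : y ∈ IComp k s t sp l) :
    DI k s sp (HI k s t sp y) + HI k s t sp (DI k s sp y) = y := by
  induction h using Submodule.span_induction with
  | mem y hy =>
    obtain ⟨x, hx, rfl⟩ := hy
    rw [HI_single, DI_single, homotopy_single k s t sp hsp hx]
  | zero => simp
  | add f g _ _ hf hg =>
    simp only [map_add]
    conv_rhs => rw [← hf, ← hg]
    abel
  | smul c f _ hf =>
    simp only [map_smul]
    rw [← smul_add, hf]

theorem DI_mem (hsp : ∀ i, s (sp i) = i) {l : ℤ} {y : IdxI V E →₀ k}
    (h : y ∈ IComp k s t sp l) : DI k s sp y ∈ IComp k s t sp (l + 1) := by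
  have : IComp k s t sp l ≤ (IComp k s t sp (l + 1)).comap (DI k s sp) := by
    refine Submodule.span_le.2 ?_
    rintro _ ⟨x, hx, rfl⟩
    simp only [SetLike.mem_coe, Submodule.mem_comap, DI_single]
    exact D_mem k s t sp hsp hx
  exact this h

theorem HI_mem (hsp : ∀ i, s (sp i) = i) {l : ℤ} {y : IdxI V E →₀ k}
    (h : y ∈ IComp k s t sp l) : HI k s t sp y ∈ IComp k s t sp (l - 1) := by
  have : IComp k s t sp l ≤ (IComp k s t sp (l - 1)).comap (HI k s t sp) := by
    refine Submodule.span_le.2 ?_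
    rintro _ ⟨x, hx, rfl⟩
    simp only [SetLike.mem_coe, Submodule.mem_comap, HI_single]
    exact H_mem k s t sp hsp hx
  exact this h

end LeavittAux

/-- The injective Leavitt complex of a finite graph without sinks (with a
chosen special edge `sp i` starting at each vertex `i`) is acyclic: for every
integer `l`, the kernel of `∂^l : I^l → I^{l+1}` equals the image of
`∂^{l-1} : I^{l-1} → I^l`. -/
theorem injectiveLeavitt_acyclic (k : Type) [Field k] {V E : Type}
    [Fintype V] [Fintype E] (s t : E → V) (sp : V → E)
    (hsp : ∀ i, s (sp i) = i) (l : ℤ) :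
    {x : IdxI V E →₀ k | x ∈ IComp k s t sp l ∧ DI k s sp x = 0} =
      (DI k s sp) '' (IComp k s t sp (l - 1) : Set (IdxI V E →₀ k)) := by
  ext x
  constructor
  · rintro ⟨hx, h0⟩
    refine ⟨HI k s t sp x, HI_mem k s t sp hsp hx, ?_⟩
    have := homotopy k s t sp hsp hx
    rwa [h0, map_zero, add_zero] at this
  · rintro ⟨y, hy, rfl⟩
    refine ⟨?_, DI_DI k s sp y⟩
    have := DI_mem k s t sp hsp hy
    rwa [sub_add_cancel] at this
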